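/- arXiv:1711.07877 — 2 statements merged into one kernel-verified Lean document; each statement's English description precedes it below -/
import Mathlib

section
/- For every positive integer p, the p-th positive root ρ_p of the Bessel function J_0 satisfies π(p - 1/4) ≤ ρ_p ≤ π(p - 1/8). -/
open Real

/-- Bessel function of the first kind of integer order `α`. -/
noncomputable def besselJ (α : ℕ) (r : ℝ) : ℝ :=
  ∑' m : ℕ, ((-1:ℝ)^m / ((Nat.factorial m) * (Nat.factorial (m+α)))) * (r/2)^(2*m+α)


theorem bz_ps (c : ℕ → ℝ) (hc : ∀ m, |c m| ≤ 1 / (Nat.factorial m : ℝ)) (y : ℝ) :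
    Summable (fun m => c m * y ^ m) := by
  refine Summable.of_norm_bounded (g := fun m => |y| ^ m / (Nat.factorial m : ℝ))
    (Real.summable_pow_div_factorial |y|) ?_
  intro m
  rw [norm_mul, norm_pow, Real.norm_eq_abs, Real.norm_eq_abs]
  calc |c m| * |y| ^ m ≤ 1 / (Nat.factorial m : ℝ) * |y| ^ m := by gcongr; exact hc m
    _ = _ := by ring

theorem bz_ps_deriv (c : ℕ → ℝ) (hc : ∀ m, |c m| ≤ 1 / (Nat.factorial m : ℝ)) (y : ℝ) :
    HasDerivAt (fun y => ∑' m, c m * y ^ m) (∑' m : ℕ, ((m + 1 : ℕ) : ℝ) * c (m + 1) * y ^ m) y := by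
  have hsm : Summable (fun m : ℕ => (m : ℝ) * (|y| + 1) ^ (m - 1) / (Nat.factorial m : ℝ)) := by
    rw [← summable_nat_add_iff 1]
    refine (Real.summable_pow_div_factorial (|y| + 1)).congr ?_
    intro m
    rw [Nat.factorial_succ]
    push_cast
    field_simp
  have h := hasDerivAt_tsum_of_isPreconnected (t := Metric.ball (0 : ℝ) (|y| + 1))
    (g := fun m y => c m * y ^ m) (g' := fun m y => c m * (m * y ^ (m - 1)))
    (y₀ := y) (y := y) hsm Metric.isOpen_ball (convex_ball _ _).isPreconnected
    (fun n x _ => (hasDerivAt_pow n x).const_mul (c n))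
    (by
      intro n x hx
      have hx' : |x| ≤ |y| + 1 := by
        have := Metric.mem_ball.1 hx
        rw [Real.dist_eq, sub_zero] at this
        exact this.le
      rw [norm_mul, norm_mul, norm_pow, Real.norm_eq_abs, Real.norm_eq_abs, Real.norm_eq_abs, Nat.abs_cast]
      calc |c n| * (n * |x| ^ (n - 1)) ≤ 1 / (Nat.factorial n : ℝ) * (n * (|y| + 1) ^ (n - 1)) := by
            gcongr; exact hc n
        _ = _ := by ring)
    (by simp) (bz_ps c hc y) (by simp)
  have hs : Summable (fun m : ℕ => c m * (m * y ^ (m - 1))) := by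
    refine Summable.of_norm_bounded hsm ?_
    intro n
    rw [norm_mul, norm_mul, norm_pow, Real.norm_eq_abs, Real.norm_eq_abs, Real.norm_eq_abs, Nat.abs_cast]
    calc |c n| * (n * |y| ^ (n - 1)) ≤ 1 / (Nat.factorial n : ℝ) * (n * (|y| + 1) ^ (n - 1)) := by
          gcongr
          · exact hc n
          · linarith
      _ = _ := by ring
  refine h.congr_deriv ?_
  rw [hs.tsum_eq_zero_add]
  simp only [Nat.cast_zero, zero_mul, mul_zero, zero_add, Nat.add_sub_cancel]
  refine tsum_congr fun m => ?_
  ring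

noncomputable def bzc (m : ℕ) : ℝ := (-1 : ℝ) ^ m / ((Nat.factorial m) * (Nat.factorial m))
noncomputable def bzc1 (m : ℕ) : ℝ := ((m + 1 : ℕ) : ℝ) * bzc (m + 1)
noncomputable def bzc2 (m : ℕ) : ℝ := ((m + 1 : ℕ) : ℝ) * bzc1 (m + 1)

theorem bzc_rec (m : ℕ) : ((m + 1 : ℕ) : ℝ) * bzc1 m = - bzc m := by
  have : (Nat.factorial m : ℝ) ≠ 0 := by positivity
  have h2 : ((m : ℝ) + 1) ≠ 0 := by positivity
  unfold bzc1 bzc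
  rw [Nat.factorial_succ, pow_succ]
  push_cast
  field_simp

theorem bzc_le (m : ℕ) : |bzc m| ≤ 1 / (Nat.factorial m : ℝ) := by
  have h1 : (1 : ℝ) ≤ Nat.factorial m := by exact_mod_cast Nat.factorial_pos m
  unfold bzc
  rw [abs_div, abs_pow, abs_neg, abs_one, one_pow, abs_of_pos (by positivity)]
  apply one_div_le_one_div_of_le (by positivity)
  nlinarith

theorem bzc1_le (m : ℕ) : |bzc1 m| ≤ 1 / (Nat.factorial m : ℝ) := by
  have h := bzc_rec m
  have h1 : |((m + 1 : ℕ) : ℝ)| * |bzc1 m| ≤ 1 / (Nat.factorial m : ℝ) := by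
    rw [← abs_mul, h, abs_neg]; exact bzc_le m
  rw [Nat.abs_cast] at h1
  push_cast at h1
  have : (0 : ℝ) ≤ m := by positivity
  nlinarith [abs_nonneg (bzc1 m), mul_nonneg this (abs_nonneg (bzc1 m))]

noncomputable def bzf (y : ℝ) : ℝ := ∑' m, bzc m * y ^ m
noncomputable def bzf1 (y : ℝ) : ℝ := ∑' m, bzc1 m * y ^ m
noncomputable def bzf2 (y : ℝ) : ℝ := ∑' m, bzc2 m * y ^ m

theorem bzf_deriv (y : ℝ) : HasDerivAt bzf (bzf1 y) y := bz_ps_deriv bzc bzc_le y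
theorem bzf1_deriv (y : ℝ) : HasDerivAt bzf1 (bzf2 y) y := bz_ps_deriv bzc1 bzc1_le y

theorem bzc2_le (m : ℕ) : |bzc2 m| ≤ 1 / (Nat.factorial m : ℝ) := by
  have h : bzc2 m = - bzc (m + 1) + - bzc1 (m + 1) := by
    rw [← bzc_rec (m + 1)]; unfold bzc2; push_cast; ring
  have h : bzc2 m = - bzc (m+1) - bzc1 (m+1) := by rw [h]; ring
  have h3 := bzc_rec (m + 1)
  have h4 : bzc2 m * (m + 2) = - (m + 1) * bzc (m + 1) := by
    unfold bzc2; push_cast at h3 ⊢; linear_combination (m + 1 : ℝ) * h3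
  have h5 : ((m : ℝ) + 1) * |bzc (m + 1)| ≤ 1 / (Nat.factorial m : ℝ) := by
    have := bzc_le (m + 1)
    rw [Nat.factorial_succ] at this
    push_cast at this
    calc ((m : ℝ) + 1) * |bzc (m + 1)| ≤ (m + 1) * (1 / ((m + 1) * (Nat.factorial m : ℝ))) := by gcongr
      _ = _ := by field_simp
  have h6 : |bzc2 m| * (m + 2) = (m + 1) * |bzc (m + 1)| := by
    have := congrArg abs h4
    rwa [abs_mul, abs_mul, abs_neg, abs_of_pos (by positivity : (0 : ℝ) < m + 2),
      abs_of_pos (by positivity : (0 : ℝ) < (m : ℝ) + 1)] at this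
  have : (0 : ℝ) ≤ m := by positivity
  nlinarith [abs_nonneg (bzc2 m), mul_nonneg this (abs_nonneg (bzc2 m))]

theorem bzf_ode (y : ℝ) : y * bzf2 y + bzf1 y + bzf y = 0 := by
  have s0 := bz_ps bzc bzc_le y
  have s1 := bz_ps bzc1 bzc1_le y
  have s2 := bz_ps bzc2 bzc2_le y
  have e1 : bzf1 y = bzc1 0 + ∑' m, bzc1 (m + 1) * y ^ (m + 1) := by
    unfold bzf1; rw [s1.tsum_eq_zero_add]; simp
  have e0 : bzf y = bzc 0 + ∑' m, bzc (m + 1) * y ^ (m + 1) := by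
    unfold bzf; rw [s0.tsum_eq_zero_add]; simp
  have e2 : y * bzf2 y = ∑' m, bzc2 m * y ^ (m + 1) := by
    unfold bzf2; rw [← tsum_mul_left]; refine tsum_congr fun m => ?_; ring
  have t0 := (summable_nat_add_iff 1).2 s0
  have t1 := (summable_nat_add_iff 1).2 s1
  have e3 : y * bzf2 y = ∑' m, (- (bzc1 (m + 1) * y ^ (m + 1)) - bzc (m + 1) * y ^ (m + 1)) := by
    rw [e2]; refine tsum_congr fun m => ?_
    have h3 := bzc_rec (m + 1)
    unfold bzc2; push_cast at h3 ⊢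
    linear_combination y ^ (m + 1) * h3
  rw [t1.neg.tsum_sub t0, tsum_neg] at e3
  have := bzc_rec 0
  push_cast at this
  rw [e3, e0, e1]
  linear_combination this

theorem bzf_neg : bzf (1.8225) < 0 := by
  have s0 := bz_ps bzc bzc_le 1.8225
  unfold bzf
  rw [← s0.sum_add_tsum_nat_add 5]
  have hb : ∀ m, bzc (m + 5) * (1.8225 : ℝ) ^ (m + 5) ≤ (32 / 14400) * (1 / 3 : ℝ) ^ m := by
    intro m
    have h2 : (120 : ℝ) * 6 ^ m ≤ Nat.factorial (m + 5) := by
      have := @Nat.factorial_mul_pow_le_factorial 5 m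
      rw [add_comm m 5]
      exact_mod_cast this
    have h3 : (120 : ℝ) ≤ Nat.factorial (m + 5) := by
      have : (1 : ℝ) ≤ 6 ^ m := one_le_pow₀ (by norm_num)
      linarith
    have h1 : |bzc (m + 5)| ≤ 1 / (120 * (120 * 6 ^ m)) := by
      unfold bzc
      rw [abs_div, abs_pow, abs_neg, abs_one, one_pow, abs_of_pos (by positivity)]
      apply one_div_le_one_div_of_le (by positivity)
      gcongr
    calc bzc (m + 5) * (1.8225 : ℝ) ^ (m + 5) ≤ |bzc (m + 5)| * (1.8225 : ℝ) ^ (m + 5) := by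
          gcongr; exact le_abs_self _
      _ ≤ (1 / (120 * (120 * 6 ^ m))) * 2 ^ (m + 5) := by
          gcongr
          norm_num
      _ = _ := by
          rw [pow_add, show (6 : ℝ) = 2 * 3 by norm_num, mul_pow, one_div_pow]
          field_simp
          norm_num
  have hg : Summable (fun m : ℕ => (32 / 14400) * (1 / 3 : ℝ) ^ m) :=
    (summable_geometric_of_lt_one (by norm_num) (by norm_num)).mul_left _
  have ht := ((summable_nat_add_iff 5).2 s0).tsum_le_tsum hb hg
  rw [tsum_mul_left, tsum_geometric_of_lt_one (by norm_num) (by norm_num)] at ht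
  refine lt_of_le_of_lt (add_le_add_right ht _) ?_
  simp only [Finset.sum_range_succ, Finset.sum_range_zero, bzc, Nat.factorial]
  norm_num

noncomputable def bzJ (x : ℝ) : ℝ := bzf (x ^ 2 / 4)
noncomputable def bzD (x : ℝ) : ℝ := x / 2 * bzf1 (x ^ 2 / 4)

theorem bzJ_eq (α : ℝ) : ∑' m : ℕ, ((-1:ℝ)^m / ((Nat.factorial m) * (Nat.factorial (m+0)))) * (α/2)^(2*m+0)
    = bzJ α := by
  unfold bzJ bzf bzc
  refine tsum_congr fun m => ?_
  rw [add_zero, add_zero, pow_mul]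
  congr 2
  ring

theorem bzJ_zero : bzJ 0 = 1 := by
  rw [← bzJ_eq, tsum_eq_single 0]
  · simp
  · intro m hm
    simp [hm]

theorem bzD_zero : bzD 0 = 0 := by simp [bzD]

theorem bzJ_neg : bzJ 2.7 < 0 := by
  have := bzf_neg
  unfold bzJ
  norm_num at this ⊢
  exact this

theorem bzJ_deriv (x : ℝ) : HasDerivAt bzJ (bzD x) x := by
  have h : HasDerivAt (fun x : ℝ => x ^ 2 / 4) (x / 2) x :=
    ((hasDerivAt_pow 2 x).div_const 4).congr_deriv (by norm_num; ring)
  exact ((bzf_deriv (x ^ 2 / 4)).comp x h).congr_deriv (by unfold bzD; ring)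

theorem bzD_deriv' (x : ℝ) : HasDerivAt bzD (- bzJ x - bzf1 (x ^ 2 / 4) / 2) x := by
  have h : HasDerivAt (fun x : ℝ => x ^ 2 / 4) (x / 2) x :=
    ((hasDerivAt_pow 2 x).div_const 4).congr_deriv (by norm_num; ring)
  have h1 := (((hasDerivAt_id x).div_const 2)).mul ((bzf1_deriv (x ^ 2 / 4)).comp x h)
  refine h1.congr_deriv ?_
  have := bzf_ode (x ^ 2 / 4)
  unfold bzJ
  simp only [id, Function.comp]
  linear_combination this

theorem bzD_deriv (x : ℝ) (hx : 0 < x) : HasDerivAt bzD (- bzJ x - bzD x / x) x := by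
  refine (bzD_deriv' x).congr_deriv ?_
  unfold bzD
  field_simp

theorem bzJ_cont : Continuous bzJ :=
  continuous_iff_continuousAt.2 fun x => (bzJ_deriv x).continuousAt
theorem bzD_cont : Continuous bzD :=
  continuous_iff_continuousAt.2 fun x => (bzD_deriv' x).continuousAt

theorem bz_energy (x : ℝ) (hx : 0 ≤ x) : bzJ x ^ 2 + bzD x ^ 2 ≤ 1 := by
  have h : AntitoneOn (fun x => bzJ x ^ 2 + bzD x ^ 2) (Set.Ici 0) := by
    refine antitoneOn_of_hasDerivWithinAt_nonpos (f' := fun x => - (2 * bzD x ^ 2 / x)) (convex_Ici 0)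
      ((bzJ_cont.pow 2).add (bzD_cont.pow 2)).continuousOn ?_ ?_
    · intro x hx
      rw [interior_Ici] at hx
      have hx : 0 < x := hx
      refine (((bzJ_deriv x).pow 2).add ((bzD_deriv x hx).pow 2)).hasDerivWithinAt.congr_deriv ?_
      field_simp
      norm_num
      ring
    · intro x hx
      rw [interior_Ici] at hx
      have hx : 0 < x := hx
      have : 0 ≤ 2 * bzD x ^ 2 / x := by positivity
      linarith
  have := h (Set.mem_Ici.2 le_rfl) (Set.mem_Ici.2 hx) hx
  simpa [bzJ_zero, bzD_zero] using this

theorem bzJ_abs (x : ℝ) (hx : 0 ≤ x) : |bzJ x| ≤ 1 :=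
  abs_le_one_iff_mul_self_le_one.2 (by nlinarith [bz_energy x hx, sq_nonneg (bzD x)])
theorem bzD_abs (x : ℝ) (hx : 0 ≤ x) : |bzD x| ≤ 1 :=
  abs_le_one_iff_mul_self_le_one.2 (by nlinarith [bz_energy x hx, sq_nonneg (bzJ x)])

theorem bzJ_pos (x : ℝ) (hx : 0 ≤ x) (hx1 : x ≤ 1 / 2) : 0 < bzJ x := by
  have h : MonotoneOn (fun x => bzJ x + x) (Set.Ici 0) := by
    refine monotoneOn_of_hasDerivWithinAt_nonneg (f' := fun x => bzD x + 1) (convex_Ici 0)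
      (bzJ_cont.add continuous_id).continuousOn ?_ ?_
    · intro x hx
      exact ((bzJ_deriv x).add (hasDerivAt_id x)).hasDerivWithinAt
    · intro x hx
      rw [interior_Ici] at hx
      have := abs_le.1 (bzD_abs x (le_of_lt hx))
      linarith
  have := h (Set.mem_Ici.2 le_rfl) (Set.mem_Ici.2 hx) hx
  simp [bzJ_zero] at this
  linarith

theorem bz_ne (x : ℝ) (hx : 0 < x) : 0 < bzJ x ^ 2 + bzD x ^ 2 := by
  have h : MonotoneOn (fun x => (x * bzJ x) ^ 2 + (x * bzD x) ^ 2) (Set.Ici 0) := by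
    refine monotoneOn_of_hasDerivWithinAt_nonneg (f' := fun x => 2 * x * bzJ x ^ 2) (convex_Ici 0)
      (((continuous_id.mul bzJ_cont).pow 2).add ((continuous_id.mul bzD_cont).pow 2)).continuousOn ?_ ?_
    · intro x hx
      rw [interior_Ici] at hx
      have hx : 0 < x := hx
      refine ((((hasDerivAt_id x).mul (bzJ_deriv x)).pow 2).add
        (((hasDerivAt_id x).mul (bzD_deriv x hx)).pow 2)).hasDerivWithinAt.congr_deriv ?_
      simp only [id, Pi.mul_apply]
      field_simp
      norm_num
      ring
    · intro x hx
      rw [interior_Ici] at hx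
      have hx : 0 < x := hx
      positivity
  rcases le_total x (1 / 2) with h1 | h1
  · have := bzJ_pos x hx.le h1
    positivity
  · have h2 := h (Set.mem_Ici.2 (by norm_num : (0 : ℝ) ≤ 1 / 2)) (Set.mem_Ici.2 hx.le) h1
    have h3 := bzJ_pos (1 / 2) (by norm_num) le_rfl
    have h4 : 0 < (1 / 2 * bzJ (1 / 2)) ^ 2 + (1 / 2 * bzD (1 / 2)) ^ 2 := by positivity
    have h5 : 0 < x ^ 2 * (bzJ x ^ 2 + bzD x ^ 2) := by
      refine lt_of_lt_of_le h4 (h2.trans (le_of_eq ?_))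
      simp only []
      ring
    exact (mul_pos_iff_of_pos_left (by positivity)).1 h5

theorem bz_bd (f : ℝ → ℂ) (C : ℝ) (hC : 0 ≤ C) (hb : ∀ x, 0 ≤ x → ‖f x‖ ≤ C * (1 + x))
    (s : ℂ) (hs : 0 < s.re) (x : ℝ) (hx : 0 ≤ x) :
    ‖Complex.exp (-(s * x)) * f x‖ ≤ (C * (1 + 2 / s.re)) * Real.exp (-(s.re / 2) * x) := by
  rw [norm_mul, Complex.norm_exp]
  have e1 : (-(s * (x : ℂ))).re = -(s.re / 2) * x + -(s.re / 2 * x) := by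
    simp; ring
  rw [e1, Real.exp_add]
  have h1 : 1 + x ≤ (1 + 2 / s.re) * Real.exp (s.re / 2 * x) := by
    have h2 := Real.add_one_le_exp (s.re / 2 * x)
    have h3 : (1 : ℝ) ≤ Real.exp (s.re / 2 * x) := Real.one_le_exp (by positivity)
    have h4 : x = 2 / s.re * (s.re / 2 * x) := by field_simp
    have h5 : 2 / s.re * (s.re / 2 * x) ≤ 2 / s.re * Real.exp (s.re / 2 * x) := by
      gcongr; linarith
    nlinarith
  have h6 : Real.exp (-(s.re / 2 * x)) * (1 + x) ≤ 1 + 2 / s.re := by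
    rw [Real.exp_neg, inv_mul_le_iff₀ (Real.exp_pos _)]
    linarith
  calc Real.exp (-(s.re / 2) * x) * Real.exp (-(s.re / 2 * x)) * ‖f x‖
      ≤ Real.exp (-(s.re / 2) * x) * Real.exp (-(s.re / 2 * x)) * (C * (1 + x)) := by
        gcongr; exact hb x hx
    _ = (C * Real.exp (-(s.re / 2) * x)) * (Real.exp (-(s.re / 2 * x)) * (1 + x)) := by ring
    _ ≤ (C * Real.exp (-(s.re / 2) * x)) * (1 + 2 / s.re) := by gcongr
    _ = _ := by ring

theorem bz_int (f : ℝ → ℂ) (hf : Continuous f) (C : ℝ) (hC : 0 ≤ C)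
    (hb : ∀ x, 0 ≤ x → ‖f x‖ ≤ C * (1 + x)) (s : ℂ) (hs : 0 < s.re) :
    MeasureTheory.IntegrableOn (fun x : ℝ => Complex.exp (-(s * x)) * f x) (Set.Ioi 0) := by
  have h1 : MeasureTheory.IntegrableOn
      (fun x : ℝ => (C * (1 + 2 / s.re)) * Real.exp (-(s.re / 2) * x)) (Set.Ioi 0) :=
    (exp_neg_integrableOn_Ioi 0 (half_pos hs)).const_mul _
  refine MeasureTheory.Integrable.mono' h1 ?_ ?_
  · exact (Continuous.aestronglyMeasurable (by fun_prop))
  · refine (MeasureTheory.ae_restrict_iff' measurableSet_Ioi).2 (.of_forall fun x hx => ?_)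
    exact bz_bd f C hC hb s hs x (le_of_lt hx)

theorem bz_tend (f : ℝ → ℂ) (C : ℝ) (hC : 0 ≤ C)
    (hb : ∀ x, 0 ≤ x → ‖f x‖ ≤ C * (1 + x)) (s : ℂ) (hs : 0 < s.re) :
    Filter.Tendsto (fun x : ℝ => Complex.exp (-(s * x)) * f x) Filter.atTop (nhds 0) := by
  have h0 : Filter.Tendsto (fun x : ℝ => (C * (1 + 2 / s.re)) * Real.exp (-(s.re / 2) * x))
      Filter.atTop (nhds 0) := by
    have : Filter.Tendsto (fun x : ℝ => Real.exp (-(s.re / 2) * x)) Filter.atTop (nhds 0) := by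
      refine Real.tendsto_exp_atBot.comp ?_
      exact Filter.tendsto_id.const_mul_atTop_of_neg (by linarith)
    simpa using this.const_mul (C * (1 + 2 / s.re))
  refine squeeze_zero_norm' ?_ h0
  filter_upwards [Filter.eventually_ge_atTop 0] with x hx
  exact bz_bd f C hC hb s hs x hx

noncomputable def bzM (s : ℂ) : ℂ := ∫ x in Set.Ioi (0 : ℝ), Complex.exp (-(s * x)) * (bzJ x : ℂ)
noncomputable def bzN (s : ℂ) : ℂ := ∫ x in Set.Ioi (0 : ℝ), Complex.exp (-(s * x)) * (x * bzJ x : ℂ)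
noncomputable def bzP (s : ℂ) : ℂ := ∫ x in Set.Ioi (0 : ℝ), Complex.exp (-(s * x)) * (bzD x : ℂ)

theorem bz_cJ : Continuous (fun x => (bzJ x : ℂ)) := Complex.continuous_ofReal.comp bzJ_cont
theorem bz_cD : Continuous (fun x => (bzD x : ℂ)) := Complex.continuous_ofReal.comp bzD_cont
theorem bz_cxJ : Continuous (fun x : ℝ => (x * bzJ x : ℂ)) := Complex.continuous_ofReal.mul bz_cJ
theorem bz_bJ (x : ℝ) (hx : 0 ≤ x) : ‖(bzJ x : ℂ)‖ ≤ 1 * (1 + x) := by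
  rw [Complex.norm_real, Real.norm_eq_abs]; linarith [bzJ_abs x hx]
theorem bz_bD (x : ℝ) (hx : 0 ≤ x) : ‖(bzD x : ℂ)‖ ≤ 1 * (1 + x) := by
  rw [Complex.norm_real, Real.norm_eq_abs]; linarith [bzD_abs x hx]
theorem bz_bxJ (x : ℝ) (hx : 0 ≤ x) : ‖(x * bzJ x : ℂ)‖ ≤ 1 * (1 + x) := by
  rw [norm_mul, Complex.norm_real, Complex.norm_real, Real.norm_eq_abs, Real.norm_eq_abs, abs_of_nonneg hx]
  nlinarith [bzJ_abs x hx]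
theorem bz_bxD (x : ℝ) (hx : 0 ≤ x) : ‖(x * bzD x : ℂ)‖ ≤ 1 * (1 + x) := by
  rw [norm_mul, Complex.norm_real, Complex.norm_real, Real.norm_eq_abs, Real.norm_eq_abs, abs_of_nonneg hx]
  nlinarith [bzD_abs x hx]

theorem bz_dexp (s : ℂ) (x : ℝ) :
    HasDerivAt (fun x : ℝ => Complex.exp (-(s * x))) (-s * Complex.exp (-(s * x))) x := by
  have h : HasDerivAt (fun x : ℝ => -(s * (x : ℂ))) (-s) x := by
    have hd : HasDerivAt (fun x : ℝ => (x : ℂ)) 1 x := Complex.ofRealCLM.hasDerivAt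
    exact (hd.const_mul s).neg.congr_deriv (by ring)
  exact h.cexp.congr_deriv (by ring)

theorem bzP_eq (s : ℂ) (hs : 0 < s.re) : bzP s = -1 + s * bzM s := by
  have iJ := bz_int _ bz_cJ 1 zero_le_one bz_bJ s hs
  have iD := bz_int _ bz_cD 1 zero_le_one bz_bD s hs
  have h := MeasureTheory.integral_Ioi_of_hasDerivAt_of_tendsto'
    (f := fun x : ℝ => Complex.exp (-(s * x)) * (bzJ x : ℂ))
    (f' := fun x : ℝ => Complex.exp (-(s * x)) * (bzD x : ℂ) - s * (Complex.exp (-(s * x)) * (bzJ x : ℂ)))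
    (a := 0) (m := 0)
    (fun x _ => ((bz_dexp s x).mul (bzJ_deriv x).ofReal_comp).congr_deriv (by ring))
    (iD.sub (iJ.const_mul s)) (bz_tend _ 1 zero_le_one bz_bJ s hs)
  rw [MeasureTheory.integral_sub iD (iJ.const_mul s), MeasureTheory.integral_const_mul] at h
  simp only [Complex.ofReal_zero, mul_zero, neg_zero, Complex.exp_zero, bzJ_zero, Complex.ofReal_one] at h
  unfold bzP bzM
  linear_combination h

theorem bzN_eq (s : ℂ) (hs : 0 < s.re) : (1 + s ^ 2) * bzN s = s * bzM s := by
  have iJ := bz_int _ bz_cJ 1 zero_le_one bz_bJ s hs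
  have iX := bz_int _ bz_cxJ 1 zero_le_one bz_bxJ s hs
  have t1 := bz_tend _ 1 zero_le_one bz_bxD s hs
  have t2 := bz_tend _ 1 zero_le_one bz_bxJ s hs
  have h := MeasureTheory.integral_Ioi_of_hasDerivAt_of_tendsto
    (f := fun x : ℝ => Complex.exp (-(s * x)) * (x * bzD x : ℂ)
      + s * (Complex.exp (-(s * x)) * (x * bzJ x : ℂ)))
    (f' := fun x : ℝ => s * (Complex.exp (-(s * x)) * (bzJ x : ℂ))
      - (1 + s ^ 2) * (Complex.exp (-(s * x)) * (x * bzJ x : ℂ)))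
    (a := 0) (m := 0) (by
      have := bz_cJ
      have := bz_cD
      exact Continuous.continuousWithinAt (by fun_prop))
    (fun x hx => by
      have hx : 0 < x := hx
      have hd : HasDerivAt (fun x : ℝ => (x : ℂ)) 1 x := Complex.ofRealCLM.hasDerivAt
      refine (((bz_dexp s x).mul (hd.mul (bzD_deriv x hx).ofReal_comp)).add
        (((bz_dexp s x).mul (hd.mul (bzJ_deriv x).ofReal_comp)).const_mul s)).congr_deriv ?_
      have : (x : ℂ) ≠ 0 := by exact_mod_cast hx.ne'
      simp only [Pi.mul_apply]
      push_cast
      field_simp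
      ring)
    (((iJ.const_mul s).sub (iX.const_mul (1 + s ^ 2))).congr (.of_forall fun x => rfl)) (by simpa using t1.add (t2.const_mul s))
  rw [MeasureTheory.integral_sub (iJ.const_mul s) (iX.const_mul (1 + s ^ 2)), MeasureTheory.integral_const_mul,
    MeasureTheory.integral_const_mul] at h
  simp only [Complex.ofReal_zero, mul_zero, zero_mul, add_zero, sub_zero] at h
  unfold bzN bzM
  linear_combination -h

theorem bzM_deriv (ε : ℝ) (hε : 0 < ε) (τ : ℝ) :
    HasDerivAt (fun τ : ℝ => bzM (ε - Complex.I * τ)) (Complex.I * bzN (ε - Complex.I * τ)) τ := by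
  have hre : ∀ τ : ℝ, ((ε : ℂ) - Complex.I * τ).re = ε := by intro τ; simp
  have h := hasDerivAt_integral_of_dominated_loc_of_deriv_le (μ := MeasureTheory.volume.restrict (Set.Ioi 0))
    (F := fun (τ : ℝ) (x : ℝ) => Complex.exp (-((ε - Complex.I * τ) * x)) * (bzJ x : ℂ))
    (F' := fun (τ : ℝ) (x : ℝ) => Complex.I * (Complex.exp (-((ε - Complex.I * τ) * x)) * (x * bzJ x : ℂ)))
    (bound := fun x => (1 * (1 + 2 / ε)) * Real.exp (-(ε / 2) * x))
    (x₀ := τ) (s := Set.univ) Filter.univ_mem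
    (.of_forall fun τ => (bz_int _ bz_cJ 1 zero_le_one bz_bJ _ (by rw [hre]; exact hε)).aestronglyMeasurable)
    (bz_int _ bz_cJ 1 zero_le_one bz_bJ _ (by rw [hre]; exact hε))
    ((bz_int _ bz_cxJ 1 zero_le_one bz_bxJ _
      (by rw [hre]; exact hε)).const_mul Complex.I).aestronglyMeasurable
    ((MeasureTheory.ae_restrict_iff' measurableSet_Ioi).2 (.of_forall fun x hx τ _ => by
      rw [norm_mul, Complex.norm_I, one_mul]
      have := bz_bd _ 1 zero_le_one bz_bxJ (ε - Complex.I * τ) (by rw [hre]; exact hε) x (le_of_lt hx)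
      rwa [hre] at this))
    ((exp_neg_integrableOn_Ioi 0 (half_pos hε)).const_mul _)
    (.of_forall fun x τ _ => by
      have h : HasDerivAt (fun τ : ℝ => -(((ε : ℂ) - Complex.I * τ) * x)) (Complex.I * x) τ := by
        have hd : HasDerivAt (fun x : ℝ => (x : ℂ)) 1 τ := Complex.ofRealCLM.hasDerivAt
        exact ((((hd.const_mul Complex.I).const_sub (ε : ℂ)).mul_const (x : ℂ)).neg).congr_deriv (by ring)
      exact (h.cexp.mul_const _).congr_deriv (by ring))
  refine h.2.congr_deriv ?_
  rw [MeasureTheory.integral_const_mul]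
  rfl

theorem bzM_real (ε : ℝ) : ∃ r : ℝ, bzM ε = r := by
  refine ⟨∫ x in Set.Ioi (0 : ℝ), Real.exp (-(ε * x)) * bzJ x, ?_⟩
  unfold bzM
  rw [← integral_complex_ofReal]
  push_cast
  rfl

theorem bzM_key (ε : ℝ) (hε : 0 < ε) :
    ∃ r : ℝ, 0 ≤ r ∧ (ε ^ 2 - 2 * Complex.I * ε) * bzM (ε - Complex.I) ^ 2 = r := by
  have hc : ∀ τ : ℝ, HasDerivAt (fun τ : ℝ => (1 + ((ε : ℂ) - Complex.I * τ) ^ 2) *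
      bzM (ε - Complex.I * τ) ^ 2) 0 τ := by
    intro τ
    have hd : HasDerivAt (fun x : ℝ => (x : ℂ)) 1 τ := Complex.ofRealCLM.hasDerivAt
    have h1 := (hd.const_mul Complex.I).const_sub (ε : ℂ)
    have hN := bzN_eq (ε - Complex.I * τ) (by simpa using hε)
    refine (((h1.pow 2).const_add 1).mul ((bzM_deriv ε hε τ).pow 2)).congr_deriv ?_
    norm_num
    linear_combination (2 * Complex.I * bzM (ε - Complex.I * τ)) * hN
  have h := is_const_of_deriv_eq_zero (fun τ => (hc τ).differentiableAt) (fun τ => (hc τ).deriv) 1 0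
  obtain ⟨r, hr⟩ := bzM_real ε
  refine ⟨(1 + ε ^ 2) * r ^ 2, by positivity, ?_⟩
  simp only [Complex.ofReal_one, Complex.ofReal_zero, mul_one, mul_zero, sub_zero, hr] at h
  push_cast
  rw [← h]
  linear_combination (-bzM (ε - Complex.I) ^ 2) * Complex.I_sq

theorem bz_abel (K : ℝ → ℂ) (hK : Continuous K) (B : ℝ) (hB : ∀ x, 0 < x → ‖K x‖ ≤ B) (l : ℂ)
    (hl : Filter.Tendsto K Filter.atTop (nhds l)) :
    Filter.Tendsto (fun ε : ℝ => ((√ε : ℝ) : ℂ) *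
      ∫ x in Set.Ioi (0 : ℝ), ((Real.exp (-(ε * x)) * x ^ ((1 : ℝ) / 2 - 1) : ℝ) : ℂ) * K x)
      (nhdsWithin 0 (Set.Ioi 0)) (nhds ((Real.Gamma (1 / 2) : ℝ) * l)) := by
  have hG : MeasureTheory.IntegrableOn (fun t : ℝ => Real.exp (-t) * t ^ ((1 : ℝ) / 2 - 1)) (Set.Ioi 0) :=
    Real.GammaIntegral_convergent (by norm_num)
  have h1 : Filter.Tendsto (fun ε : ℝ =>
      ∫ t in Set.Ioi (0 : ℝ), ((Real.exp (-t) * t ^ ((1 : ℝ) / 2 - 1) : ℝ) : ℂ) * K (ε⁻¹ * t))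
      (nhdsWithin 0 (Set.Ioi 0))
      (nhds (∫ t in Set.Ioi (0 : ℝ), ((Real.exp (-t) * t ^ ((1 : ℝ) / 2 - 1) : ℝ) : ℂ) * l)) := by
    refine MeasureTheory.tendsto_integral_filter_of_dominated_convergence
      (fun t => (Real.exp (-t) * t ^ ((1 : ℝ) / 2 - 1)) * B) ?_ ?_ (hG.mul_const B) ?_
    · refine .of_forall fun ε => ?_
      refine MeasureTheory.AEStronglyMeasurable.mul ?_ ?_
      · exact Complex.continuous_ofReal.comp_aestronglyMeasurable hG.aestronglyMeasurable
      · exact (Continuous.aestronglyMeasurable (by fun_prop))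
    · filter_upwards [self_mem_nhdsWithin] with ε hε
      have hε : 0 < ε := hε
      refine (MeasureTheory.ae_restrict_iff' measurableSet_Ioi).2 (.of_forall fun x hx => ?_)
      have hx : 0 < x := hx
      rw [norm_mul, Complex.norm_real, Real.norm_of_nonneg (by positivity)]
      gcongr
      exact hB _ (by positivity)
    · refine (MeasureTheory.ae_restrict_iff' measurableSet_Ioi).2 (.of_forall fun x hx => ?_)
      have hx : 0 < x := hx
      refine Filter.Tendsto.const_mul _ (hl.comp ?_)
      exact tendsto_inv_nhdsGT_zero.atTop_mul_const hx
  rw [MeasureTheory.integral_mul_const, integral_complex_ofReal, ← Real.Gamma_eq_integral (by norm_num)] at h1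
  refine h1.congr' ?_
  filter_upwards [self_mem_nhdsWithin] with ε hε
  have hε : 0 < ε := hε
  have h2 := MeasureTheory.integral_comp_mul_left_Ioi
    (fun t : ℝ => ((Real.exp (-t) * t ^ ((1 : ℝ) / 2 - 1) : ℝ) : ℂ) * K (ε⁻¹ * t)) 0 hε
  rw [mul_zero] at h2
  have h3 : ∫ t in Set.Ioi (0 : ℝ), ((Real.exp (-t) * t ^ ((1 : ℝ) / 2 - 1) : ℝ) : ℂ) * K (ε⁻¹ * t)
     = ε • (ε⁻¹ • ∫ t in Set.Ioi (0 : ℝ), ((Real.exp (-t) * t ^ ((1 : ℝ) / 2 - 1) : ℝ) : ℂ) * K (ε⁻¹ * t)) := by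
    rw [smul_smul, mul_inv_cancel₀ hε.ne', one_smul]
  rw [h3, ← h2, ← MeasureTheory.integral_const_mul, ← MeasureTheory.integral_smul]
  refine MeasureTheory.setIntegral_congr_fun measurableSet_Ioi fun x hx => ?_
  have hx : 0 < x := hx
  rw [← mul_assoc ε⁻¹, inv_mul_cancel₀ hε.ne', one_mul, Real.mul_rpow hε.le hx.le, Complex.real_smul,
    ← mul_assoc (ε : ℂ), ← mul_assoc ((√ε : ℝ) : ℂ), ← Complex.ofReal_mul, ← Complex.ofReal_mul]
  congr 2
  have : ε * ε ^ ((1 : ℝ) / 2 - 1) = √ε := by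
    rw [Real.sqrt_eq_rpow]
    nth_rewrite 1 [← Real.rpow_one ε]
    rw [← Real.rpow_add hε]
    norm_num
  rw [← this]
  ring

noncomputable def bzK (x : ℝ) : ℂ := (√x : ℝ) * Complex.exp (Complex.I * x) * (bzJ x + Complex.I * bzD x)

theorem bzK_cont : Continuous bzK := by
  have := bz_cJ
  have := bz_cD
  unfold bzK
  fun_prop

theorem bzK_norm (x : ℝ) (hx : 0 ≤ x) : ‖bzK x‖ ≤ √x * 2 := by
  unfold bzK
  rw [norm_mul, norm_mul, Complex.norm_real, Real.norm_of_nonneg (Real.sqrt_nonneg x), mul_comm Complex.I,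
    Complex.norm_exp_ofReal_mul_I, mul_one]
  gcongr
  refine (norm_add_le _ _).trans ?_
  rw [norm_mul, Complex.norm_I, Complex.norm_real, Complex.norm_real, Real.norm_eq_abs, Real.norm_eq_abs]
  linarith [bzJ_abs x hx, bzD_abs x hx]

theorem bzK_int (ε : ℝ) (hε : 0 < ε) :
    ∫ x in Set.Ioi (0 : ℝ), ((Real.exp (-(ε * x)) * x ^ ((1 : ℝ) / 2 - 1) : ℝ) : ℂ) * bzK x
     = (2 + Complex.I * ε) * bzM (ε - Complex.I) - Complex.I := by
  have hs : 0 < ((ε : ℂ) - Complex.I).re := by simpa using hε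
  have iJ := bz_int _ bz_cJ 1 zero_le_one bz_bJ _ hs
  have iD := bz_int _ bz_cD 1 zero_le_one bz_bD _ hs
  have h1 : ∫ x in Set.Ioi (0 : ℝ), ((Real.exp (-(ε * x)) * x ^ ((1 : ℝ) / 2 - 1) : ℝ) : ℂ) * bzK x
     = ∫ x in Set.Ioi (0 : ℝ), (Complex.exp (-((ε - Complex.I) * x)) * (bzJ x : ℂ) +
        Complex.I * (Complex.exp (-((ε - Complex.I) * x)) * (bzD x : ℂ))) := by
    refine MeasureTheory.setIntegral_congr_fun measurableSet_Ioi fun x hx => ?_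
    have hx : 0 < x := hx
    have h2 : x ^ ((1 : ℝ) / 2 - 1) * √x = 1 := by
      rw [Real.sqrt_eq_rpow, ← Real.rpow_add hx]; norm_num
    have h2' : ((x ^ ((1 : ℝ) / 2 - 1) : ℝ) : ℂ) * (√x : ℝ) = 1 := by exact_mod_cast h2
    have h3 : Complex.exp (-((ε - Complex.I) * x)) = Complex.exp (-(ε * x)) * Complex.exp (Complex.I * x) := by
      rw [← Complex.exp_add]; congr 1; ring
    rw [h3]
    unfold bzK
    push_cast at h2' ⊢
    linear_combination (Complex.exp (-(ε * x)) * Complex.exp (Complex.I * x) * (bzJ x + Complex.I * bzD x)) * h2'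
  rw [h1, MeasureTheory.integral_add iJ (iD.const_mul _), MeasureTheory.integral_const_mul]
  have h4 := bzP_eq _ hs
  change bzM _ + Complex.I * bzP _ = _
  rw [h4]
  linear_combination (-bzM (ε - Complex.I)) * Complex.I_sq

theorem bz_limit (l : ℂ) (hl : Filter.Tendsto bzK Filter.atTop (nhds l)) :
    ∃ r : ℝ, 0 ≤ r ∧ - Complex.I * l ^ 2 = r := by
  obtain ⟨B, hB⟩ : ∃ B, ∀ x, 0 < x → ‖bzK x‖ ≤ B := by
    have h1 := hl.norm.eventually (gt_mem_nhds (lt_add_one ‖l‖))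
    obtain ⟨X, hX⟩ := Filter.eventually_atTop.1 h1
    refine ⟨max (‖l‖ + 1) (√X * 2), fun x hx => ?_⟩
    rcases le_total X x with h | h
    · exact le_max_of_le_left (hX x h).le
    · refine le_max_of_le_right ((bzK_norm x hx.le).trans ?_)
      gcongr
  have h := bz_abel bzK bzK_cont B hB l hl
  have h0 : Filter.Tendsto (fun ε : ℝ => ((√ε : ℝ) : ℂ)) (nhdsWithin 0 (Set.Ioi 0)) (nhds 0) := by
    have : Continuous (fun ε : ℝ => ((√ε : ℝ) : ℂ)) := by fun_prop
    simpa using (this.tendsto 0).mono_left nhdsWithin_le_nhds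
  have h00 : Filter.Tendsto (fun ε : ℝ => (ε : ℂ)) (nhdsWithin 0 (Set.Ioi 0)) (nhds 0) := by
    simpa using (Complex.continuous_ofReal.tendsto 0).mono_left nhdsWithin_le_nhds
  set G : ℂ := ((Real.Gamma (1 / 2) : ℝ) : ℂ) with hG
  have h1 : Filter.Tendsto (fun ε : ℝ => ((√ε : ℝ) : ℂ) * ((2 + Complex.I * ε) * bzM (ε - Complex.I)))
      (nhdsWithin 0 (Set.Ioi 0)) (nhds (G * l)) := by
    have := h.add (h0.mul_const Complex.I)
    rw [zero_mul, add_zero] at this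
    refine this.congr' ?_
    filter_upwards [self_mem_nhdsWithin] with ε hε
    rw [bzK_int ε hε]
    ring
  have h2 := (h1.pow 2).mul ((h00.sub_const (2 * Complex.I)))
  have h3 : Filter.Tendsto (fun ε : ℝ => (2 + Complex.I * (ε : ℂ)) ^ 2) (nhdsWithin 0 (Set.Ioi 0))
      (nhds ((2 + Complex.I * 0) ^ 2)) := ((h00.const_mul _).const_add _).pow 2
  have h4 := h2.div h3 (by norm_num)
  have hev : ∀ᶠ ε : ℝ in nhdsWithin 0 (Set.Ioi 0),
      (((√ε : ℝ) : ℂ) * ((2 + Complex.I * ε) * bzM (ε - Complex.I))) ^ 2 * (ε - 2 * Complex.I) /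
        (2 + Complex.I * (ε : ℂ)) ^ 2 ∈ Complex.ofReal '' Set.Ici 0 := by
    filter_upwards [self_mem_nhdsWithin] with ε hε
    have hε : 0 < ε := hε
    obtain ⟨r, hr, e⟩ := bzM_key ε hε
    refine ⟨r, hr, ?_⟩
    have hne : (2 + Complex.I * (ε : ℂ)) ≠ 0 := by
      intro h
      have := congrArg Complex.re h
      simp at this
    have hsq : ((√ε : ℝ) : ℂ) ^ 2 = ε := by
      rw [← Complex.ofReal_pow, Real.sq_sqrt hε.le]
    rw [← e, eq_div_iff (pow_ne_zero 2 hne)]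
    linear_combination -((2 + Complex.I * ε) * bzM (ε - Complex.I)) ^ 2 * (ε - 2 * Complex.I) * hsq
  have hcl : IsClosed (Complex.ofReal '' Set.Ici 0) :=
    Complex.isometry_ofReal.isClosedEmbedding.isClosedMap _ isClosed_Ici
  obtain ⟨r, hr, e⟩ := hcl.mem_of_tendsto h4 hev
  have hGp : 0 < Real.Gamma (1 / 2) := Real.Gamma_pos_of_pos (by norm_num)
  refine ⟨2 * r / Real.Gamma (1 / 2) ^ 2, div_nonneg (mul_nonneg zero_le_two hr) (by positivity), ?_⟩
  have hG0 : G ≠ 0 := by rw [hG]; exact_mod_cast hGp.ne'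
  push_cast
  rw [e, ← hG]
  field_simp
  ring

noncomputable def bzW (x : ℝ) : ℂ :=
  ((√x * bzJ x : ℝ) : ℂ) + Complex.I * ((bzJ x / (2 * √x) + √x * bzD x : ℝ) : ℂ)

theorem bzW_re (x : ℝ) : (bzW x).re = √x * bzJ x := by
  unfold bzW
  rw [Complex.add_re, Complex.I_mul_re, Complex.ofReal_re, Complex.ofReal_im, neg_zero, add_zero]
theorem bzW_im (x : ℝ) : (bzW x).im = bzJ x / (2 * √x) + √x * bzD x := by
  unfold bzW
  rw [Complex.add_im, Complex.I_mul_im, Complex.ofReal_re, Complex.ofReal_im, zero_add]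

theorem bzW_ne (x : ℝ) (hx : 0 < x) : bzW x ≠ 0 := by
  intro h
  have h1 := congrArg Complex.re h
  have h2 := congrArg Complex.im h
  rw [bzW_re, Complex.zero_re] at h1
  rw [bzW_im, Complex.zero_im] at h2
  have hs : √x ≠ 0 := (Real.sqrt_pos.2 hx).ne'
  have h3 : bzJ x = 0 := (mul_eq_zero.1 h1).resolve_left hs
  rw [h3, zero_div, zero_add] at h2
  have h4 : bzD x = 0 := (mul_eq_zero.1 h2).resolve_left hs
  have := bz_ne x hx
  rw [h3, h4] at this
  norm_num at this

theorem bzW_deriv (x : ℝ) (hx : 0 < x) : HasDerivAt bzW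
    (((bzJ x / (2 * √x) + √x * bzD x : ℝ) : ℂ) -
      Complex.I * (((1 + 1 / (4 * x ^ 2)) * (√x * bzJ x) : ℝ) : ℂ)) x := by
  have hs : 0 < √x := Real.sqrt_pos.2 hx
  have hsx : √x ^ 2 = x := Real.sq_sqrt hx.le
  have h0 := Real.hasDerivAt_sqrt hx.ne'
  have h1 : HasDerivAt (fun x => √x * bzJ x) (bzJ x / (2 * √x) + √x * bzD x) x :=
    (h0.mul (bzJ_deriv x)).congr_deriv (by ring)
  have h2 : HasDerivAt (fun x => bzJ x / (2 * √x) + √x * bzD x)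
      (-((1 + 1 / (4 * x ^ 2)) * (√x * bzJ x))) x := by
    refine (((bzJ_deriv x).div (h0.const_mul 2) (by positivity)).add
      (h0.mul (bzD_deriv x hx))).congr_deriv ?_
    generalize √x = s at *
    subst hsx
    field_simp
    ring
  refine (h1.ofReal_comp.add (h2.ofReal_comp.const_mul Complex.I)).congr_deriv ?_
  push_cast
  ring

noncomputable def bzg (t : ℝ) : ℂ :=
  -(Complex.I * (((√t * bzJ t / (4 * t ^ 2) : ℝ) : ℂ) / bzW t))

theorem bzg_cont : ContinuousOn bzg (Set.Ioi 0) := by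
  intro t ht
  have ht : 0 < t := ht
  have hJ := bzJ_cont
  have h1 : ContinuousAt (fun t : ℝ => √t * bzJ t / (4 * t ^ 2)) t :=
    ContinuousAt.div (by fun_prop) (by fun_prop) (by positivity)
  have h2 : ContinuousAt bzW t := (bzW_deriv t ht).continuousAt
  have h3 := (Complex.continuous_ofReal.continuousAt.comp h1).div h2 (bzW_ne t ht)
  exact ((continuousAt_const.mul h3).neg).continuousWithinAt

theorem bzg_norm (t : ℝ) (ht : 0 < t) : ‖bzg t‖ ≤ 1 / (4 * t ^ 2) := by
  have h1 := Complex.abs_re_le_norm (bzW t)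
  rw [bzW_re] at h1
  have h2 : 0 < ‖bzW t‖ := norm_pos_iff.2 (bzW_ne t ht)
  unfold bzg
  rw [norm_neg, norm_mul, Complex.norm_I, one_mul, norm_div, Complex.norm_real, Real.norm_eq_abs,
    abs_div, abs_of_pos (by positivity : 0 < 4 * t ^ 2), div_le_iff₀ h2]
  calc |√t * bzJ t| / (4 * t ^ 2) ≤ ‖bzW t‖ / (4 * t ^ 2) := by gcongr
    _ = _ := by ring

theorem bzg_im (t : ℝ) : (bzg t).im ≤ 0 := by
  unfold bzg
  rw [Complex.neg_im, Complex.I_mul_im, Complex.div_re, Complex.ofReal_re, Complex.ofReal_im, bzW_re]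
  rw [zero_mul, zero_div, add_zero]
  have h : √t * bzJ t / (4 * t ^ 2) * (√t * bzJ t) / Complex.normSq (bzW t) =
    (√t * bzJ t) ^ 2 / (4 * t ^ 2 * Complex.normSq (bzW t)) := by
      rw [div_mul_eq_mul_div, div_div, sq (√t * bzJ t)]
  rw [h]
  have := Complex.normSq_nonneg (bzW t)
  have : 0 ≤ (√t * bzJ t) ^ 2 / (4 * t ^ 2 * Complex.normSq (bzW t)) := by positivity
  linarith

noncomputable def bzL (x : ℝ) : ℂ := ∫ t in (1 / 2 : ℝ)..x, bzg t

theorem bzL_deriv (x : ℝ) (hx : 0 < x) : HasDerivAt bzL (bzg x) x := by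
  have hsub : Set.uIcc (1 / 2 : ℝ) x ⊆ Set.Ioi 0 := by
    intro y hy
    have h1 := hy.1
    have : 0 < min (1 / 2 : ℝ) x := lt_min (by norm_num) hx
    exact lt_of_lt_of_le this h1
  refine intervalIntegral.integral_hasDerivAt_right (bzg_cont.mono hsub).intervalIntegrable ?_
    (bzg_cont.continuousAt (Ioi_mem_nhds hx))
  exact bzg_cont.stronglyMeasurableAtFilter isOpen_Ioi x hx

theorem bzL_spec (x : ℝ) (hx : 0 < x) :
    Complex.exp (Complex.I * x) * bzW x =
      Complex.exp (Complex.I * (1 / 2 : ℝ)) * bzW (1 / 2) * Complex.exp (bzL x) := by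
  have hd : ∀ y ∈ Set.Ioi (0 : ℝ), HasDerivAt
      (fun x : ℝ => Complex.exp (Complex.I * x) * bzW x * Complex.exp (-bzL x)) 0 y := by
    intro y hy
    have hy : 0 < y := hy
    have h0 : HasDerivAt (fun x : ℝ => Complex.I * (x : ℂ)) Complex.I y := by
      have hd : HasDerivAt (fun x : ℝ => (x : ℂ)) 1 y := Complex.ofRealCLM.hasDerivAt
      exact (hd.const_mul Complex.I).congr_deriv (by ring)
    refine ((h0.cexp.mul (bzW_deriv y hy)).mul (bzL_deriv y hy).neg.cexp).congr_deriv ?_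
    have hne := bzW_ne y hy
    have hg : bzW y * bzg y = -(Complex.I * ((√y * bzJ y / (4 * y ^ 2) : ℝ) : ℂ)) := by
      unfold bzg
      field_simp
    have e1 : ((bzJ y / (2 * √y) + √y * bzD y : ℝ) : ℂ) + Complex.I * bzW y
        - Complex.I * (((1 + 1 / (4 * y ^ 2)) * (√y * bzJ y) : ℝ) : ℂ)
        = -(Complex.I * ((√y * bzJ y / (4 * y ^ 2) : ℝ) : ℂ)) := by
      unfold bzW
      push_cast
      linear_combination ((bzJ y : ℂ) / (2 * (√y : ℝ)) + (√y : ℝ) * bzD y) * Complex.I_sq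
    simp only [Pi.mul_apply, Pi.neg_apply]
    linear_combination (Complex.exp (Complex.I * y) * Complex.exp (-bzL y)) * (e1 - hg)
  have h := isOpen_Ioi.is_const_of_deriv_eq_zero isPreconnected_Ioi
    (fun y hy => (hd y hy).differentiableAt.differentiableWithinAt) (fun y hy => (hd y hy).deriv)
    (Set.mem_Ioi.2 hx) (Set.mem_Ioi.2 (by norm_num : (0 : ℝ) < 1 / 2))
  have h0 : bzL (1 / 2) = 0 := by simp [bzL]
  simp only [h0, neg_zero, Complex.exp_zero, mul_one] at h
  rw [← h, mul_assoc _ (Complex.exp (-bzL x)), ← Complex.exp_add, neg_add_cancel, Complex.exp_zero, mul_one]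

theorem bzg_bound_int : MeasureTheory.IntegrableOn (fun t : ℝ => 1 / (4 * t ^ 2)) (Set.Ioi (1 / 2)) ∧
    ∫ t in Set.Ioi (1 / 2 : ℝ), 1 / (4 * t ^ 2) = 1 / 2 := by
  have e : Set.EqOn (fun t : ℝ => (1 / 4 : ℝ) * t ^ (-2 : ℝ)) (fun t : ℝ => 1 / (4 * t ^ 2))
      (Set.Ioi (1 / 2)) := by
    intro t ht
    have ht : 1 / 2 < t := ht
    have ht0 : 0 < t := by linarith
    change (1 / 4 : ℝ) * t ^ (-2 : ℝ) = 1 / (4 * t ^ 2)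
    rw [Real.rpow_neg ht0.le, Real.rpow_ofNat]
    field_simp
  constructor
  · have h : MeasureTheory.IntegrableOn (fun t : ℝ => (1 / 4 : ℝ) * t ^ (-2 : ℝ)) (Set.Ioi (1 / 2)) :=
      (integrableOn_Ioi_rpow_of_lt (by norm_num) (by norm_num)).const_mul _
    exact h.congr_fun e measurableSet_Ioi
  · rw [← MeasureTheory.setIntegral_congr_fun measurableSet_Ioi e, MeasureTheory.integral_const_mul,
      integral_Ioi_rpow_of_lt (by norm_num) (by norm_num)]
    norm_num [Real.rpow_neg_one]

noncomputable def bzA (x : ℝ) : ℝ := 1 / 2 + (bzW (1 / 2)).arg + (bzL x).im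

theorem bzA_deriv (x : ℝ) (hx : 0 < x) : HasDerivAt bzA ((bzg x).im) x :=
  (Complex.imCLM.hasFDerivAt.comp_hasDerivAt x (bzL_deriv x hx)).const_add _

theorem bzA_anti : AntitoneOn bzA (Set.Ioi 0) := by
  refine antitoneOn_of_hasDerivWithinAt_nonpos (f' := fun x => (bzg x).im) (convex_Ioi 0)
    (fun x hx => (bzA_deriv x hx).continuousAt.continuousWithinAt) ?_ (fun x _ => bzg_im x)
  intro x hx
  rw [interior_Ioi] at hx
  exact (bzA_deriv x hx).hasDerivWithinAt

theorem bzA_polar (l : ℂ) : Complex.exp (Complex.I * (1 / 2 : ℝ)) * bzW (1 / 2) * Complex.exp l =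
    ((‖bzW (1 / 2)‖ * Real.exp l.re : ℝ) : ℂ) *
      Complex.exp (Complex.I * ((1 / 2 + (bzW (1 / 2)).arg + l.im : ℝ) : ℂ)) := by
  nth_rewrite 1 [← Complex.norm_mul_exp_arg_mul_I (bzW (1 / 2))]
  nth_rewrite 1 [← Complex.re_add_im l]
  rw [Complex.exp_add]
  push_cast
  rw [mul_add, mul_add, Complex.exp_add, Complex.exp_add, mul_comm Complex.I (l.im : ℂ),
    mul_comm Complex.I ((bzW (1 / 2)).arg : ℂ)]
  ring

theorem bzA_zero (x : ℝ) (hx : 0 < x) : bzJ x = 0 ↔ cos (x - bzA x) = 0 := by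
  have h := bzL_spec x hx
  rw [bzA_polar] at h
  have h1 : bzW x = ((‖bzW (1 / 2)‖ * Real.exp (bzL x).re : ℝ) : ℂ) *
      Complex.exp (((bzA x - x : ℝ) : ℂ) * Complex.I) := by
    have h2 : Complex.exp (-(Complex.I * x)) * Complex.exp (Complex.I * x) = 1 := by
      rw [← Complex.exp_add, neg_add_cancel, Complex.exp_zero]
    have h3 : Complex.exp (((bzA x - x : ℝ) : ℂ) * Complex.I) =
        Complex.exp (-(Complex.I * x)) * Complex.exp (Complex.I * (bzA x : ℝ)) := by
      rw [← Complex.exp_add]; congr 1; push_cast; ring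
    rw [h3]
    unfold bzA
    linear_combination Complex.exp (-(Complex.I * x)) * h - bzW x * h2
  have h4 := congrArg Complex.re h1
  rw [bzW_re, Complex.re_ofReal_mul, Complex.exp_ofReal_mul_I_re, ← cos_neg, neg_sub] at h4
  have hs : √x ≠ 0 := (Real.sqrt_pos.2 hx).ne'
  have hn : ‖bzW (1 / 2)‖ * Real.exp (bzL x).re ≠ 0 :=
    mul_ne_zero (norm_ne_zero_iff.2 (bzW_ne _ (by norm_num))) (Real.exp_pos _).ne'
  constructor
  · intro h0
    rw [h0, mul_zero] at h4
    exact (mul_eq_zero.1 h4.symm).resolve_left hn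
  · intro h0
    rw [h0, mul_zero] at h4
    exact (mul_eq_zero.1 h4).resolve_left hs

theorem bzA_half : |bzA (1 / 2) - 1 / 2| < π / 2 := by
  have h0 : bzL (1 / 2) = 0 := by simp [bzL]
  unfold bzA
  rw [h0, Complex.zero_im, add_zero, add_sub_cancel_left, Complex.abs_arg_lt_pi_div_two_iff]
  left
  rw [bzW_re]
  exact mul_pos (Real.sqrt_pos.2 (by norm_num)) (bzJ_pos _ (by norm_num) le_rfl)

theorem bzA_lim : Filter.Tendsto bzA Filter.atTop (nhds (π / 4)) := by
  obtain ⟨hi, hv⟩ := bzg_bound_int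
  have hpos : ∀ t ∈ Set.Ioi (1 / 2 : ℝ), 0 < t := fun t ht => by
    have : 1 / 2 < t := ht
    linarith
  have hb : ∀ᵐ t ∂(MeasureTheory.volume.restrict (Set.Ioi (1 / 2 : ℝ))), ‖bzg t‖ ≤ 1 / (4 * t ^ 2) :=
    (MeasureTheory.ae_restrict_iff' measurableSet_Ioi).2 (.of_forall fun t ht => bzg_norm t (hpos t ht))
  have hg : MeasureTheory.IntegrableOn bzg (Set.Ioi (1 / 2)) :=
    MeasureTheory.Integrable.mono' hi
      ((bzg_cont.mono fun t ht => hpos t ht).aestronglyMeasurable measurableSet_Ioi) hb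
  have hL : Filter.Tendsto bzL Filter.atTop (nhds (∫ t in Set.Ioi (1 / 2 : ℝ), bzg t)) :=
    MeasureTheory.intervalIntegral_tendsto_integral_Ioi _ hg Filter.tendsto_id
  have hn : ‖∫ t in Set.Ioi (1 / 2 : ℝ), bzg t‖ ≤ 1 / 2 := by
    exact (MeasureTheory.norm_integral_le_of_norm_le hi hb).trans hv.le
  generalize (∫ t in Set.Ioi (1 / 2 : ℝ), bzg t) = l at hL hn
  have hA : Filter.Tendsto bzA Filter.atTop (nhds (1 / 2 + (bzW (1 / 2)).arg + l.im)) :=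
    ((Complex.continuous_im.tendsto l).comp hL).const_add _
  have hK : Filter.Tendsto bzK Filter.atTop (nhds (((‖bzW (1 / 2)‖ * Real.exp l.re : ℝ) : ℂ) *
      Complex.exp (Complex.I * ((1 / 2 + (bzW (1 / 2)).arg + l.im : ℝ) : ℂ)))) := by
    rw [← bzA_polar]
    have h1 := (((Complex.continuous_exp.tendsto l).comp hL).const_mul
      (Complex.exp (Complex.I * (1 / 2 : ℝ)) * bzW (1 / 2)))
    have h2 : Filter.Tendsto (fun x : ℝ => Complex.I * Complex.exp (Complex.I * x) *
        ((bzJ x / (2 * √x) : ℝ) : ℂ)) Filter.atTop (nhds 0) := by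
      have h3 : Filter.Tendsto (fun x : ℝ => 1 / 2 * (√x)⁻¹) Filter.atTop (nhds 0) := by
        simpa using (tendsto_inv_atTop_zero.comp Real.tendsto_sqrt_atTop).const_mul (1 / 2 : ℝ)
      refine squeeze_zero_norm' ?_ h3
      filter_upwards [Filter.eventually_gt_atTop 0] with x hx
      have hs : 0 < √x := Real.sqrt_pos.2 hx
      rw [norm_mul, norm_mul, Complex.norm_I, mul_comm Complex.I, Complex.norm_exp_ofReal_mul_I,
        Complex.norm_real, Real.norm_eq_abs, abs_div, abs_of_pos (by positivity : 0 < 2 * √x)]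
      have := bzJ_abs x hx.le
      calc 1 * 1 * (|bzJ x| / (2 * √x)) ≤ 1 * 1 * (1 / (2 * √x)) := by gcongr
        _ = _ := by field_simp
    have h4 := h1.sub h2
    rw [sub_zero] at h4
    refine h4.congr' ?_
    filter_upwards [Filter.eventually_gt_atTop 0] with x hx
    have := bzL_spec x hx
    simp only [Function.comp]
    rw [← this]
    unfold bzK bzW
    push_cast
    ring
  obtain ⟨r, hr, e⟩ := bz_limit _ hK
  have hW : 0 < ‖bzW (1 / 2)‖ * Real.exp l.re :=
    mul_pos (norm_pos_iff.2 (bzW_ne _ (by norm_num))) (Real.exp_pos _)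
  have h0 : bzL (1 / 2) = 0 := by simp [bzL]
  have hA0 : bzA (1 / 2) = 1 / 2 + (bzW (1 / 2)).arg := by
    unfold bzA; rw [h0, Complex.zero_im, add_zero]
  have hle : 1 / 2 + (bzW (1 / 2)).arg + l.im ≤ bzA (1 / 2) := by
    refine le_of_tendsto hA ?_
    filter_upwards [Filter.eventually_ge_atTop (1 / 2)] with x hx
    exact bzA_anti (Set.mem_Ioi.2 (by norm_num)) (Set.mem_Ioi.2 (by linarith)) hx
  have him := (abs_le.1 ((Complex.abs_im_le_norm l).trans hn)).1
  have harg := abs_lt.1 bzA_half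
  generalize ‖bzW (1 / 2)‖ * Real.exp l.re = R at e hW
  have ha : 1 / 2 + (bzW (1 / 2)).arg + l.im = π / 4 := by
    have hlo : -(π / 2) < 1 / 2 + (bzW (1 / 2)).arg + l.im := by linarith
    have hhi : 1 / 2 + (bzW (1 / 2)).arg + l.im < 1 / 2 + π / 2 := by linarith
    generalize 1 / 2 + (bzW (1 / 2)).arg + l.im = a at e hlo hhi
    have e2 : (-Complex.I * ((R : ℂ) * Complex.exp (Complex.I * (a : ℂ))) ^ 2)
        = (-Complex.I) * (((R ^ 2 : ℝ) : ℂ) * Complex.exp (((2 * a : ℝ) : ℂ) * Complex.I)) := by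
      rw [mul_pow, ← Complex.exp_nat_mul]
      push_cast
      congr 3
      ring
    rw [e2] at e
    have ere := congrArg Complex.re e
    have eim := congrArg Complex.im e
    rw [neg_mul, Complex.neg_re, Complex.I_mul_re, Complex.im_ofReal_mul, Complex.exp_ofReal_mul_I_im,
      Complex.ofReal_re] at ere
    rw [neg_mul, Complex.neg_im, Complex.I_mul_im, Complex.re_ofReal_mul, Complex.exp_ofReal_mul_I_re,
      Complex.ofReal_im] at eim
    have hR : 0 < R ^ 2 := by positivity
    have hc : cos (2 * a) = 0 := (mul_eq_zero.1 (neg_eq_zero.1 eim)).resolve_left hR.ne'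
    obtain ⟨k, hk⟩ := Real.cos_eq_zero_iff.1 hc
    have hpi := Real.pi_gt_three
    have k1 : (-2 : ℝ) < k := by
      by_contra hcon
      push Not at hcon
      nlinarith
    have k2 : (k : ℝ) < 1 := by
      by_contra hcon
      push Not at hcon
      nlinarith
    have k1' : -2 < k := by exact_mod_cast k1
    have k2' : k < 1 := by exact_mod_cast k2
    have : k = -1 ∨ k = 0 := by omega
    rcases this with rfl | rfl
    · exfalso
      have h5 : 2 * a = -(π / 2) := by rw [hk]; push_cast; ring
      rw [h5, sin_neg, sin_pi_div_two] at ere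
      linarith
    · push_cast at hk
      linarith
  rwa [ha] at hA

theorem bzA_ge (x : ℝ) (hx : 0 < x) : π / 4 ≤ bzA x := by
  refine le_of_tendsto bzA_lim ?_
  filter_upwards [Filter.eventually_ge_atTop x] with y hy
  exact bzA_anti (Set.mem_Ioi.2 hx) (Set.mem_Ioi.2 (hx.trans_le hy)) hy

theorem bz_theta_mono : StrictMonoOn (fun x => x - bzA x) (Set.Ioi 0) := by
  intro x hx y hy hxy
  have := bzA_anti hx hy hxy.le
  simp only []
  linarith

theorem bz_exists (n : ℕ) : ∃ x, 1 / 2 < x ∧ x - bzA x = (n + 1 / 2) * π := by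
  have hh := abs_lt.1 bzA_half
  have hpi := Real.pi_pos
  have hn : (0 : ℝ) ≤ n := Nat.cast_nonneg n
  have hnp : 0 ≤ n * π := by positivity
  set X : ℝ := (n + 1 / 2) * π + bzA (1 / 2) with hX
  have hX1 : 1 / 2 ≤ X := by rw [hX]; nlinarith
  have hc : ContinuousOn (fun x => x - bzA x) (Set.Icc (1 / 2) X) := fun x hx =>
    (continuousAt_id.sub (bzA_deriv x (by linarith [hx.1])).continuousAt).continuousWithinAt
  have hXA := bzA_anti (Set.mem_Ioi.2 (by norm_num)) (Set.mem_Ioi.2 (by linarith)) hX1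
  obtain ⟨x, hx, e⟩ := intermediate_value_Icc hX1 hc
    (show (n + 1 / 2) * π ∈ Set.Icc (1 / 2 - bzA (1 / 2)) (X - bzA X) from ⟨by nlinarith, by
      rw [hX] at hXA ⊢; linarith⟩)
  refine ⟨x, lt_of_le_of_ne hx.1 ?_, e⟩
  rintro rfl
  simp only [] at e
  nlinarith

theorem bz_cos (n : ℕ) : cos ((n + 1 / 2) * π) = 0 :=
  Real.cos_eq_zero_iff.2 ⟨n, by push_cast; ring⟩

theorem bz_enum : ∃ σ : ℕ → ℝ, StrictMono σ ∧ (∀ n, 1 / 2 < σ n ∧ σ n - bzA (σ n) = (n + 1 / 2) * π) ∧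
    ∀ x, (0 < x ∧ bzJ x = 0) ↔ ∃ n, σ n = x := by
  choose σ hσ using bz_exists
  have hp : ∀ n, 0 < σ n := fun n => by linarith [(hσ n).1]
  refine ⟨σ, ?_, hσ, ?_⟩
  · intro m n hmn
    rw [← bz_theta_mono.lt_iff_lt (hp m) (hp n)]
    rw [(hσ m).2, (hσ n).2]
    have : (m : ℝ) < n := by exact_mod_cast hmn
    have := Real.pi_pos
    nlinarith
  · intro x
    constructor
    · rintro ⟨hx, h0⟩
      have hx2 : 1 / 2 < x := by
        by_contra hcon
        push Not at hcon
        exact (bzJ_pos x hx.le hcon).ne' h0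
      have hm := bz_theta_mono (Set.mem_Ioi.2 (by norm_num)) (Set.mem_Ioi.2 hx) hx2
      simp only [] at hm
      have hh := abs_lt.1 bzA_half
      obtain ⟨k, hk⟩ := Real.cos_eq_zero_iff.1 ((bzA_zero x hx).1 h0)
      have hpi := Real.pi_pos
      have hk1 : (-1 : ℝ) < k := by
        by_contra hcon
        push Not at hcon
        nlinarith
      have hk2 : 0 ≤ k := by
        have : -1 < k := by exact_mod_cast hk1
        omega
      obtain ⟨n, rfl⟩ := Int.eq_ofNat_of_zero_le hk2
      refine ⟨n, bz_theta_mono.injOn (Set.mem_Ioi.2 (hp n)) (Set.mem_Ioi.2 hx) ?_⟩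
      rw [(hσ n).2, hk]
      push_cast
      ring
    · rintro ⟨n, rfl⟩
      exact ⟨hp n, (bzA_zero _ (hp n)).2 (by rw [(hσ n).2]; exact bz_cos n)⟩

/-- The p-th positive root `ρ_p` of `J₀` satisfies `π(p - 1/4) ≤ ρ_p ≤ π(p - 1/8)`. -/
theorem stmt0 (ρ : ℕ → ℝ)
    (hpos : ∀ p, 1 ≤ p → 0 < ρ p)
    (hmono : StrictMonoOn ρ {p : ℕ | 1 ≤ p})
    (hzero : ∀ p, 1 ≤ p → besselJ 0 (ρ p) = 0)
    (hall : ∀ x : ℝ, 0 < x → besselJ 0 x = 0 → ∃ p, 1 ≤ p ∧ ρ p = x) :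
    ∀ p : ℕ, 1 ≤ p → π * ((p : ℝ) - 1/4) ≤ ρ p ∧ ρ p ≤ π * ((p : ℝ) - 1/8) := by
  have hJ : ∀ x, besselJ 0 x = bzJ x := fun x => bzJ_eq x
  obtain ⟨σ, hσm, hσ, hσz⟩ := bz_enum
  have hρm : StrictMono (fun n => ρ (n + 1)) := fun m n hmn =>
    hmono (show 1 ≤ m + 1 by omega) (show 1 ≤ n + 1 by omega) (by omega)
  have hr : Set.range (fun n => ρ (n + 1)) = Set.range σ := by
    ext x
    constructor
    · rintro ⟨n, rfl⟩
      exact (hσz _).1 ⟨hpos _ (by omega), by rw [← hJ]; exact hzero _ (by omega)⟩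
    · rintro ⟨n, rfl⟩
      obtain ⟨h1, h2⟩ := (hσz _).2 ⟨n, rfl⟩
      obtain ⟨p, hp, e⟩ := hall _ h1 (by rw [hJ]; exact h2)
      exact ⟨p - 1, by simp only []; rw [Nat.sub_add_cancel hp]; exact e⟩
  have he := (StrictMono.range_inj hρm hσm).1 hr
  have h0 : σ 0 ≤ 2.7 := by
    obtain ⟨z, hz, e⟩ := intermediate_value_Icc' (show (1 / 2 : ℝ) ≤ 2.7 by norm_num) bzJ_cont.continuousOn
      (show (0 : ℝ) ∈ Set.Icc (bzJ 2.7) (bzJ (1 / 2)) from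
        ⟨bzJ_neg.le, (bzJ_pos _ (by norm_num) le_rfl).le⟩)
    obtain ⟨n, hn⟩ := (hσz z).1 ⟨by linarith [hz.1], e⟩
    have := hσm.monotone (Nat.zero_le n)
    rw [hn] at this
    exact this.trans hz.2
  intro p hp
  obtain ⟨n, rfl⟩ := Nat.exists_eq_add_of_le' hp
  have hn : ρ (n + 1) = σ n := congrFun he n
  obtain ⟨g1, g2⟩ := hσ n
  obtain ⟨k1, k2⟩ := hσ 0
  have hge := bzA_ge (σ n) (by linarith)
  have hle := bzA_anti (Set.mem_Ioi.2 (by linarith : 0 < σ 0)) (Set.mem_Ioi.2 (by linarith : 0 < σ n))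
    (hσm.monotone (Nat.zero_le n))
  have hpi := Real.pi_gt_d2
  push_cast at k2 ⊢
  rw [hn]
  constructor <;> nlinarith
end

section
/- For any positive integer M, real r > 0 with M ≥ (e/2) r, and any phase φ ∈ R, the error of the M-point circular quadrature for J_0 satisfies |J_0(r) − (1/M) Σ_{m=0}^{M−1} e^{i r sin(2πm/M − φ)}| ≤ K (er/(2M))^M for some absolute constant K. -/
open Real Complex

lemma bq_hasSum_congr {ι E : Type*} [AddCommMonoid E] [TopologicalSpace E] {f g : ι → E} {a : E}
    (h : ∀ i, f i = g i) : HasSum f a ↔ HasSum g a := by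
  rw [funext h]

noncomputable def bqF (s : ℝ) (p : ℕ × ℕ) : ℂ :=
  (s : ℂ) ^ p.1 / (p.1.factorial : ℂ) * ((-(s : ℂ)) ^ p.2 / (p.2.factorial : ℂ))

noncomputable def bqC (s : ℝ) (n : ℤ) : ℂ :=
  ∑' q : {p : ℕ × ℕ // (p.1 : ℤ) - (p.2 : ℤ) = n}, bqF s q.1

lemma bq_hasSum_F (s : ℝ) (z : ℂ) (hz : z ≠ 0) :
    HasSum (fun p : ℕ × ℕ => bqF s p * z ^ ((p.1 : ℤ) - (p.2 : ℤ)))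
      (Complex.exp (s * z - s / z)) := by
  have key : ∀ w : ℂ, HasSum (fun n : ℕ => w ^ n / (n.factorial : ℂ)) (Complex.exp w) := by
    intro w
    rw [Complex.exp_eq_exp_ℂ]
    exact NormedSpace.expSeries_div_hasSum_exp w
  have h1 := key (s * z)
  have h2 := key (-s / z)
  have hs := summable_mul_of_summable_norm h1.summable.norm h2.summable.norm
  have h3 := h1.mul h2 hs
  rw [← Complex.exp_add] at h3
  have e1 : (s * z - s / z : ℂ) = s * z + -s / z := by ring
  rw [e1]
  refine (bq_hasSum_congr fun p => ?_).mpr h3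
  unfold bqF
  rw [zpow_sub₀ hz, zpow_natCast, zpow_natCast, mul_pow, div_pow]
  ring

lemma bq_hasSum_C (s : ℝ) (z : ℂ) (hz : z ≠ 0) :
    HasSum (fun n : ℤ => bqC s n * z ^ n) (Complex.exp (s * z - s / z)) := by
  have h := bq_hasSum_F s z hz
  rw [← (Equiv.sigmaFiberEquiv (fun p : ℕ × ℕ => (p.1 : ℤ) - (p.2 : ℤ))).hasSum_iff] at h
  refine HasSum.sigma h ?_
  intro n
  have h1 := (bq_hasSum_F s 1 one_ne_zero).summable
  simp only [one_zpow, mul_one] at h1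
  have h2 : HasSum (fun q : {p : ℕ × ℕ // (p.1 : ℤ) - (p.2 : ℤ) = n} => bqF s q.1) (bqC s n) :=
    (h1.comp_injective Subtype.val_injective).hasSum
  refine (bq_hasSum_congr fun q => ?_).mpr (h2.mul_right (z ^ n))
  simp only [Function.comp, Equiv.sigmaFiberEquiv_apply]
  rw [q.2]

lemma bq_C_zero (r : ℝ) : bqC (r / 2) 0 = (besselJ 0 r : ℂ) := by
  unfold bqC besselJ
  let e : ℕ ≃ {p : ℕ × ℕ // (p.1 : ℤ) - (p.2 : ℤ) = 0} :=
    { toFun := fun n => ⟨(n, n), by simp⟩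
      invFun := fun q => q.1.1
      left_inv := fun n => rfl
      right_inv := fun q => by
        obtain ⟨⟨a, b⟩, h⟩ := q
        simp only [Subtype.mk.injEq, Prod.mk.injEq, true_and]
        simp only at h
        omega }
  rw [← e.tsum_eq, Complex.ofReal_tsum]
  congr 1
  ext n
  simp only [e, Equiv.coe_fn_mk, bqF]
  push_cast
  rw [neg_pow (r / 2 : ℂ)]
  simp only [add_zero]
  rw [two_mul, pow_add]
  ring

lemma bq_integral (k : ℤ) :
    ∫ θ in (0 : ℝ)..(2 * π), Complex.exp (k * θ * I) = if k = 0 then (2 * π : ℂ) else 0 := by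
  split_ifs with h
  · simp [h]
  · have hk : (k * I : ℂ) ≠ 0 := by simp [h]
    have := integral_exp_mul_complex (a := 0) (b := 2 * π) hk
    have e : ∀ θ : ℝ, (k * θ * I : ℂ) = k * I * θ := fun θ => by ring
    simp_rw [e]
    rw [this]
    have e2 : (k * I * ((2 * π : ℝ) : ℂ)) = k * (2 * π * I) := by push_cast; ring
    rw [e2, Complex.exp_int_mul_two_pi_mul_I]
    simp

lemma bq_bound (s ρ : ℝ) (hs : 0 ≤ s) (hρ : 0 < ρ) (n : ℤ) :
    ‖bqC s n‖ * ρ ^ n ≤ Real.exp (s * |ρ - 1 / ρ|) := by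
  have hρ' : (ρ : ℂ) ≠ 0 := by exact_mod_cast hρ.ne'
  set z : ℝ → ℂ := fun θ => ρ * Complex.exp (θ * I) with hz
  have hz0 : ∀ θ, z θ ≠ 0 := fun θ => mul_ne_zero hρ' (Complex.exp_ne_zero _)
  have hsum : Summable (fun k : ℤ => ‖bqC s k * (ρ : ℂ) ^ k‖) :=
    (bq_hasSum_C s ρ hρ').summable.norm
  have h := intervalIntegral.hasSum_integral_of_dominated_convergence
    (μ := MeasureTheory.volume) (a := 0) (b := 2 * π)
    (F := fun (k : ℤ) (θ : ℝ) => bqC s k * ρ ^ k * Complex.exp (((k - n : ℤ) : ℂ) * θ * I))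
    (f := fun θ => Complex.exp (s * z θ - s / z θ) * Complex.exp (-n * θ * I))
    (fun (k : ℤ) (_ : ℝ) => ‖bqC s k * (ρ : ℂ) ^ k‖)
    (fun k => by
      apply Continuous.aestronglyMeasurable
      fun_prop)
    (fun k => by
      refine Filter.Eventually.of_forall fun θ _ => ?_
      rw [norm_mul]
      have : ‖Complex.exp (((k - n : ℤ) : ℂ) * θ * I)‖ = 1 := by
        have := Complex.norm_exp_ofReal_mul_I ((k - n : ℤ) * θ)
        push_cast at this ⊢
        exact this
      rw [this, mul_one])
    (Filter.Eventually.of_forall fun θ _ => hsum)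
    (by simp)
    (by
      refine Filter.Eventually.of_forall fun θ _ => ?_
      have := (bq_hasSum_C s (z θ) (hz0 θ)).mul_right (Complex.exp (-n * θ * I))
      refine (bq_hasSum_congr fun k => ?_).mpr this
      simp only [hz]
      have ee : Complex.exp (((k - n : ℤ) : ℂ) * θ * I)
          = Complex.exp (k * (θ * I)) * Complex.exp (-n * θ * I) := by
        rw [← Complex.exp_add]
        congr 1
        push_cast
        ring
      rw [mul_zpow, ← Complex.exp_int_mul, ee]
      ring)
  simp_rw [intervalIntegral.integral_const_mul, bq_integral] at h
  have h' : HasSum (fun k : ℤ => bqC s k * (ρ : ℂ) ^ k * (if k - n = 0 then (2 * π : ℂ) else 0))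
      (bqC s n * (ρ : ℂ) ^ n * (2 * π)) := by
    convert hasSum_single n ?_ using 1
    · simp
    · intro k hk
      simp [sub_ne_zero.2 hk]
  have heq := h'.unique h
  have hb := intervalIntegral.norm_integral_le_of_norm_le_const (a := 0) (b := 2 * π)
    (f := fun θ => Complex.exp (s * z θ - s / z θ) * Complex.exp (-n * θ * I))
    (C := Real.exp (s * |ρ - 1 / ρ|)) (by
      intro θ _
      have h1 : ‖Complex.exp (-n * θ * I)‖ = 1 := by
        have := Complex.norm_exp_ofReal_mul_I (-n * θ)
        push_cast at this ⊢
        exact this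
      rw [norm_mul, h1, mul_one, Complex.norm_exp]
      apply Real.exp_le_exp.2
      have h2 : (s * z θ - s / z θ : ℂ).re = s * ((ρ - 1 / ρ) * Real.cos θ) := by
        have : (s * z θ - s / z θ : ℂ) =
            ((s * ρ : ℝ) : ℂ) * Complex.exp ((θ : ℝ) * I) - 
            ((s / ρ : ℝ) : ℂ) * Complex.exp (((-θ : ℝ) : ℂ) * I) := by
          simp only [hz]
          push_cast
          rw [neg_mul, Complex.exp_neg]
          have := Complex.exp_ne_zero (θ * I)
          field_simp
        rw [this, Complex.sub_re, Complex.re_ofReal_mul, Complex.re_ofReal_mul,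
          Complex.exp_ofReal_mul_I_re, Complex.exp_ofReal_mul_I_re, Real.cos_neg]
        ring
      rw [h2]
      apply mul_le_mul_of_nonneg_left _ hs
      calc _ ≤ |(ρ - 1 / ρ) * Real.cos θ| := le_abs_self _
        _ = |ρ - 1 / ρ| * |Real.cos θ| := abs_mul _ _
        _ ≤ |ρ - 1 / ρ| * 1 := by gcongr; exact Real.abs_cos_le_one θ
        _ = _ := mul_one _)
  rw [← heq] at hb
  have hpi : 0 < 2 * π := by positivity
  have e3 : ‖bqC s n * (ρ : ℂ) ^ n * (2 * π)‖ = ‖bqC s n‖ * ρ ^ n * (2 * π) := by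
    simp [abs_of_pos hρ, abs_of_pos Real.pi_pos]
  rw [e3, sub_zero, abs_of_pos hpi] at hb
  exact le_of_mul_le_mul_right hb hpi

/-- averages over the quadrature nodes -/
lemma bq_avg (M : ℕ) (hM : 0 < M) (φ : ℝ) (n : ℤ) :
    (1 / M : ℂ) * ∑ m ∈ Finset.range M, Complex.exp (((2 * π * m / M - φ : ℝ) : ℂ) * I) ^ n
      = if (M : ℤ) ∣ n then Complex.exp (-(φ : ℂ) * I) ^ n else 0 := by
  have hM' : (M : ℂ) ≠ 0 := by exact_mod_cast hM.ne'
  set w : ℂ := Complex.exp (2 * π * I / M) with hw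
  have hprim : IsPrimitiveRoot w M := Complex.isPrimitiveRoot_exp M hM.ne'
  have e : ∀ m : ℕ, Complex.exp (((2 * π * m / M - φ : ℝ) : ℂ) * I) ^ n
      = Complex.exp (-(φ : ℂ) * I) ^ n * (w ^ n) ^ m := by
    intro m
    rw [hw, ← Complex.exp_int_mul, ← Complex.exp_int_mul, ← Complex.exp_int_mul,
      ← Complex.exp_nat_mul, ← Complex.exp_add]
    congr 1
    push_cast
    field_simp
    ring
  simp_rw [e]
  rw [← Finset.mul_sum]
  split_ifs with h
  · rw [(hprim.zpow_eq_one_iff_dvd n).2 h]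
    simp
    field_simp
  · have hne : w ^ n ≠ 1 := fun hh => h ((hprim.zpow_eq_one_iff_dvd n).1 hh)
    rw [geom_sum_eq hne]
    have : (w ^ n) ^ M = 1 := by
      rw [← zpow_natCast, zpow_comm, zpow_natCast, hprim.pow_eq_one, one_zpow]
    rw [this]
    simp


lemma bq_repr (M : ℕ) (hM : 0 < M) (s φ : ℝ) :
    HasSum (fun n : ℤ => if (M : ℤ) ∣ n then bqC s n * Complex.exp (-(φ : ℂ) * I) ^ n else 0)
      ((1 / M : ℂ) * ∑ m ∈ Finset.range M,
        Complex.exp (Complex.I * (2 * s : ℝ) * Real.sin (2 * π * m / M - φ))) := by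
  have h : ∀ m ∈ Finset.range M, HasSum
      (fun n : ℤ => bqC s n * Complex.exp (((2 * π * m / M - φ : ℝ) : ℂ) * I) ^ n)
      (Complex.exp (Complex.I * (2 * s : ℝ) * Real.sin (2 * π * m / M - φ))) := by
    intro m _
    convert bq_hasSum_C s _ (Complex.exp_ne_zero (((2 * π * m / M - φ : ℝ) : ℂ) * I)) using 2
    generalize (2 * π * m / M - φ : ℝ) = x
    rw [div_eq_mul_inv, ← Complex.exp_neg, Complex.ofReal_sin, Complex.sin, neg_mul]
    push_cast
    linear_combination (s : ℂ) * (Complex.exp (-(x * I)) - Complex.exp (x * I)) * Complex.I_mul_I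
  have h2 := (hasSum_sum h).mul_left (1 / M : ℂ)
  refine (bq_hasSum_congr fun n => ?_).mpr h2
  have := bq_avg M hM φ n
  rw [← Finset.mul_sum, mul_left_comm, this]
  split_ifs <;> simp

lemma bq_main (M : ℕ) (r : ℝ) (hr : 0 < r) (hM : (Real.exp 1 / 2) * r ≤ M) (φ : ℝ) :
      ‖(besselJ 0 r : ℂ) -
          (1/M : ℂ) * ∑ m ∈ Finset.range M,
            Complex.exp (Complex.I * r * Real.sin (2*π*m/M - φ))‖
        ≤ 4 * (Real.exp 1 * r / (2*M))^M := by
  have hMr : (0 : ℝ) < M := lt_of_lt_of_le (by positivity) hM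
  have hM0 : 0 < M := by exact_mod_cast hMr
  set s : ℝ := r / 2 with hs
  have hs0 : 0 < s := by positivity
  set t : ℝ := s / M with ht
  have ht0 : 0 < t := by positivity
  have he2 : 2 ≤ Real.exp 1 := by have := Real.add_one_le_exp 1; linarith
  have het : Real.exp 1 * t ≤ 1 := by
    rw [ht, ← mul_div_assoc, div_le_one hMr, hs]; linarith
  have ht1 : t ≤ 1 / 2 := by nlinarith
  set q : ℝ := t ^ M with hq
  have hq0 : 0 < q := by positivity
  have hq1 : q ≤ 1 / 2 := by
    calc q ≤ t ^ 1 := pow_le_pow_of_le_one ht0.le (by linarith) hM0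
      _ ≤ 1 / 2 := by simpa using ht1
  have hsE : s * |t - 1 / t| ≤ M := by
    have : s * (1 / t) = M := by rw [ht]; field_simp
    have h1t : 1 ≤ 1 / t := by rw [le_div_iff₀ ht0]; linarith
    rw [abs_of_nonpos (by linarith)]
    nlinarith [mul_pos hs0 ht0]
  have hE : Real.exp (s * |t - 1 / t|) ≤ Real.exp 1 ^ M := by
    rw [← Real.exp_nat_mul, mul_one]
    exact Real.exp_le_exp.2 hsE
  have hE' : Real.exp (s * |t⁻¹ - 1 / t⁻¹|) ≤ Real.exp 1 ^ M := by
    rw [one_div, inv_inv, abs_sub_comm, ← one_div]; exact hE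
  -- coefficient bounds
  have hpos : ∀ k : ℕ, ‖bqC s (M * k : ℕ)‖ ≤ Real.exp 1 ^ M * q ^ k := by
    intro k
    have := (bq_bound s t⁻¹ hs0.le (by positivity) (M * k : ℕ)).trans hE'
    rw [zpow_natCast, inv_pow, pow_mul, ← hq, ← div_eq_mul_inv, div_le_iff₀ (by positivity)] at this
    exact this
  have hneg : ∀ k : ℕ, ‖bqC s (-(M * k : ℕ))‖ ≤ Real.exp 1 ^ M * q ^ k := by
    intro k
    have := (bq_bound s t hs0.le ht0 (-(M * k : ℕ))).trans hE
    rw [zpow_neg, zpow_natCast, pow_mul, ← hq, ← div_eq_mul_inv, div_le_iff₀ (by positivity)] at this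
    exact this
  set u : ℂ := Complex.exp (-(φ : ℂ) * I) with hu
  have hun : ∀ n : ℤ, ‖u ^ n‖ = 1 := by
    intro n
    have : ‖u‖ = 1 := by
      have := Complex.norm_exp_ofReal_mul_I (-φ)
      rw [hu]; push_cast at this; exact this
    rw [norm_zpow, this, one_zpow]
  have hS := bq_repr M hM0 s φ
  have e2 : (2 * s : ℝ) = r := by rw [hs]; ring
  rw [e2, ← hu] at hS
  -- reindex to multiples of M
  have hMz : (M : ℤ) ≠ 0 := by exact_mod_cast hM0.ne'
  have hinj : Function.Injective (fun k : ℤ => (M : ℤ) * k) := mul_right_injective₀ hMz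
  rw [← hinj.hasSum_iff (by
    intro n hn
    rw [if_neg]
    rintro ⟨k, hk⟩
    exact hn ⟨k, hk.symm⟩)] at hS
  set S := ((1/M : ℂ) * ∑ m ∈ Finset.range M,
            Complex.exp (Complex.I * r * Real.sin (2*π*m/M - φ))) with hSdef
  have hg : HasSum (fun k : ℤ => bqC s (M * k) * u ^ ((M : ℤ) * k)) S := by
    refine (bq_hasSum_congr fun k => ?_).mpr hS
    simp
  have hsm := hg.summable
  have hp : Summable (fun k : ℕ => bqC s (M * ((k + 1 : ℕ) : ℤ)) * u ^ ((M : ℤ) * ((k + 1 : ℕ) : ℤ))) :=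
    hsm.comp_injective (i := fun k : ℕ => ((k + 1 : ℕ) : ℤ)) (fun a b h => by simpa using h)
  have hn : Summable (fun k : ℕ => bqC s (M * (-((k + 1 : ℕ) : ℤ))) * u ^ ((M : ℤ) * (-((k + 1 : ℕ) : ℤ)))) :=
    hsm.comp_injective (i := fun k : ℕ => (-((k + 1 : ℕ) : ℤ))) (fun a b h => by simpa using h)
  have hgeo : HasSum (fun k : ℕ => Real.exp 1 ^ M * q ^ (k + 1)) (Real.exp 1 ^ M * (q * (1 - q)⁻¹)) := by
    have := ((hasSum_geometric_of_lt_one hq0.le (by linarith)).mul_left q).mul_left (Real.exp 1 ^ M)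
    refine (bq_hasSum_congr fun k => ?_).mpr this
    ring
  have hbp := tsum_of_norm_bounded (f := fun k : ℕ => bqC s (M * ((k + 1 : ℕ) : ℤ)) * u ^ ((M : ℤ) * ((k + 1 : ℕ) : ℤ))) hgeo (by
    intro k
    rw [norm_mul, hun, mul_one]
    have := hpos (k + 1)
    push_cast at this ⊢
    exact this)
  have hbn := tsum_of_norm_bounded (f := fun k : ℕ => bqC s (M * (-((k + 1 : ℕ) : ℤ))) * u ^ ((M : ℤ) * (-((k + 1 : ℕ) : ℤ)))) hgeo (by
    intro k
    rw [norm_mul, hun, mul_one]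
    have := hneg (k + 1)
    rw [mul_neg]
    push_cast at this ⊢
    exact this)
  have hsplit := HasSum.of_add_one_of_neg_add_one (f := fun k : ℤ => bqC s (M * k) * u ^ ((M : ℤ) * k))
    (by simpa using hp.hasSum) (by simpa using hn.hasSum)
  have hSeq := hg.unique hsplit
  have h0 : bqC s (M * (0 : ℤ)) * u ^ ((M : ℤ) * (0 : ℤ)) = (besselJ 0 r : ℂ) := by
    rw [mul_zero, zpow_zero, mul_one, hs, bq_C_zero]
  have hfin : q * (1 - q)⁻¹ ≤ 2 * q := by
    rw [← div_eq_mul_inv, div_le_iff₀ (by linarith)]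
    nlinarith
  have hEM : 0 < Real.exp 1 ^ M := by positivity
  have hR : (Real.exp 1 * r / (2 * M)) ^ M = Real.exp 1 ^ M * q := by
    rw [hq, ← mul_pow]; congr 1; rw [ht, hs]; field_simp
  rw [hR, hSeq, h0]
  set P := ∑' k : ℕ, bqC s (M * ((k + 1 : ℕ) : ℤ)) * u ^ ((M : ℤ) * ((k + 1 : ℕ) : ℤ))
  set N := ∑' k : ℕ, bqC s (M * (-((k + 1 : ℕ) : ℤ))) * u ^ ((M : ℤ) * (-((k + 1 : ℕ) : ℤ)))
  calc _ = ‖P + N‖ := by rw [← norm_neg]; congr 1; simp only [P, N]; push_cast; ring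
    _ ≤ ‖P‖ + ‖N‖ := norm_add_le _ _
    _ ≤ _ := by nlinarith [mul_le_mul_of_nonneg_left hfin hEM.le]

theorem stmt9 :
    ∃ K : ℝ, 0 < K ∧ ∀ (M : ℕ) (r : ℝ), 0 < r → (Real.exp 1 / 2) * r ≤ M → ∀ φ : ℝ,
      ‖(besselJ 0 r : ℂ) -
          (1/M : ℂ) * ∑ m ∈ Finset.range M,
            Complex.exp (Complex.I * r * Real.sin (2*π*m/M - φ))‖
        ≤ K * (Real.exp 1 * r / (2*M))^M := by
  exact ⟨4, by norm_num, fun M r hr hM φ => bq_main M r hr hM φ⟩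
end
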